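/- arXiv:1603.06600 — 2 statements merged into one kernel-verified Lean document; each statement's English description precedes it below -/
import Mathlib

section
/- Let c ∈ ℝ and F(t, x, y) = 1 − 24 c t + c(x³ + y³) + (x² + y²)². On the open set Ω = {(t, x, y) ∈ ℝ³ : F(t, x, y) > 0}, define v := −8 ∂_z ∂_{z̄} log F (which is real-valued) and w := 24 ∂_z² log F. Then on Ω the pair (v, w) solves the zero-energy Novikov–Veselov system: ∂_t v = 8(∂_z³ v + ∂_{z̄}³ v) + 2 ∂_z(v w) + 2 ∂_{z̄}(v \bar{w}) and ∂_{z̄} w = −3 ∂_z v. -/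
/-- Partial derivative in the time variable of a function `(t, x, y) ↦ f t x y`. -/
noncomputable def pT (f : ℝ → ℝ → ℝ → ℂ) (t x y : ℝ) : ℂ := deriv (fun s => f s x y) t

/-- Partial derivative in the `x` variable. -/
noncomputable def pX (f : ℝ → ℝ → ℝ → ℂ) (t x y : ℝ) : ℂ := deriv (fun s => f t s y) x

/-- Partial derivative in the `y` variable. -/
noncomputable def pY (f : ℝ → ℝ → ℝ → ℂ) (t x y : ℝ) : ℂ := deriv (fun s => f t x s) y

/-- Wirtinger derivative `∂_z = (1/2)(∂_x - i ∂_y)` in the spatial variables. -/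
noncomputable def pZ (f : ℝ → ℝ → ℝ → ℂ) (t x y : ℝ) : ℂ :=
  (pX f t x y - Complex.I * pY f t x y) / 2

/-- Wirtinger derivative `∂_z̄ = (1/2)(∂_x + i ∂_y)` in the spatial variables. -/
noncomputable def pZbar (f : ℝ → ℝ → ℝ → ℂ) (t x y : ℝ) : ℂ :=
  (pX f t x y + Complex.I * pY f t x y) / 2


open Complex in
noncomputable def nvP (c t : ℝ) (z w : ℂ) : ℕ → ℕ → ℂ
  | 0, 0 => 1 - 24 * c * t + c * ((1 + I) / 8 * z ^ 3 + 3 * ((1 - I) / 8) * z ^ 2 * w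
      + 3 * ((1 + I) / 8) * z * w ^ 2 + (1 - I) / 8 * w ^ 3) + z ^ 2 * w ^ 2
  | 1, 0 => c * (3 * ((1 + I) / 8) * z ^ 2 + 6 * ((1 - I) / 8) * z * w
      + 3 * ((1 + I) / 8) * w ^ 2) + 2 * z * w ^ 2
  | 0, 1 => c * (3 * ((1 - I) / 8) * z ^ 2 + 6 * ((1 + I) / 8) * z * w
      + 3 * ((1 - I) / 8) * w ^ 2) + 2 * z ^ 2 * w
  | 2, 0 => c * (6 * ((1 + I) / 8) * z + 6 * ((1 - I) / 8) * w) + 2 * w ^ 2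
  | 1, 1 => c * (6 * ((1 - I) / 8) * z + 6 * ((1 + I) / 8) * w) + 4 * z * w
  | 0, 2 => c * (6 * ((1 + I) / 8) * z + 6 * ((1 - I) / 8) * w) + 2 * z ^ 2
  | 3, 0 => c * (6 * ((1 + I) / 8))
  | 2, 1 => c * (6 * ((1 - I) / 8)) + 4 * w
  | 1, 2 => c * (6 * ((1 + I) / 8)) + 4 * z
  | 0, 3 => c * (6 * ((1 - I) / 8))
  | 2, 2 => 4
  | _, _ => 0

inductive NvE where
  | P (i j : ℕ) : NvE
  | Q : NvE
  | k (a : ℂ) : NvE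
  | add (a b : NvE) : NvE
  | mul (a b : NvE) : NvE

namespace NvE

noncomputable def zz (x y : ℝ) : ℂ := x + y * Complex.I
noncomputable def ww (x y : ℝ) : ℂ := x - y * Complex.I

noncomputable def ev (c : ℝ) : NvE → ℝ → ℝ → ℝ → ℂ
  | P i j, t, x, y => nvP c t (zz x y) (ww x y) i j
  | Q, t, x, y => (nvP c t (zz x y) (ww x y) 0 0)⁻¹
  | k a, _, _, _ => a
  | add a b, t, x, y => ev c a t x y + ev c b t x y
  | mul a b, t, x, y => ev c a t x y * ev c b t x y

noncomputable def dz : NvE → NvE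
  | P i j => P (i+1) j
  | Q => mul (k (-1)) (mul (P 1 0) (mul Q Q))
  | k _ => k 0
  | add a b => add (dz a) (dz b)
  | mul a b => add (mul (dz a) b) (mul a (dz b))

noncomputable def dw : NvE → NvE
  | P i j => P i (j+1)
  | Q => mul (k (-1)) (mul (P 0 1) (mul Q Q))
  | k _ => k 0
  | add a b => add (dw a) (dw b)
  | mul a b => add (mul (dw a) b) (mul a (dw b))

noncomputable def dt (c : ℝ) : NvE → NvE
  | P 0 0 => k (-24 * c)
  | P _ _ => k 0
  | Q => mul (k (24 * c)) (mul Q Q)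
  | k _ => k 0
  | add a b => add (dt c a) (dt c b)
  | mul a b => add (mul (dt c a) b) (mul a (dt c b))

end NvE

open NvE

lemma nvP_ofReal (c t x y : ℝ) : nvP c t (zz x y) (ww x y) 0 0 =
    ((1 - 24 * c * t + c * (x ^ 3 + y ^ 3) + (x ^ 2 + y ^ 2) ^ 2 : ℝ) : ℂ) := by
  have h : Complex.I ^ 2 = -1 := Complex.I_sq
  have h4 : Complex.I ^ 4 = 1 := Complex.I_pow_four
  simp only [nvP, zz, ww]
  push_cast
  ring_nf
  simp only [h, h4]
  ring

noncomputable def nvF (c t x y : ℝ) : ℝ :=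
  1 - 24 * c * t + c * (x ^ 3 + y ^ 3) + (x ^ 2 + y ^ 2) ^ 2

lemma zz_x (x y : ℝ) : HasDerivAt (fun s => zz s y) 1 x := by
  unfold zz
  exact ((hasDerivAt_id x).ofReal_comp).add_const _
lemma ww_x (x y : ℝ) : HasDerivAt (fun s => ww s y) 1 x := by
  unfold ww
  exact ((hasDerivAt_id x).ofReal_comp).sub_const _
lemma zz_y (x y : ℝ) : HasDerivAt (fun s => zz x s) Complex.I y := by
  unfold zz
  have := (((hasDerivAt_id y).ofReal_comp).mul_const Complex.I).const_add (x : ℂ)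
  simpa using this
lemma ww_y (x y : ℝ) : HasDerivAt (fun s => ww x s) (-Complex.I) y := by
  unfold ww
  have := (((hasDerivAt_id y).ofReal_comp).mul_const Complex.I).const_sub (x : ℂ)
  simpa using this

lemma nvP_comp (c t : ℝ) (i j : ℕ) {f g : ℝ → ℂ} {f' g' : ℂ} {s : ℝ}
    (hf : HasDerivAt f f' s) (hg : HasDerivAt g g' s) :
    HasDerivAt (fun r => nvP c t (f r) (g r) i j)
      (nvP c t (f s) (g s) (i+1) j * f' + nvP c t (f s) (g s) i (j+1) * g') s := by
  have H : ∀ a0 a1 a2 a3 a4 a5 a6 a7 a8 a9 a10 : ℂ, HasDerivAt (fun r => a0 + a1 * f r + a2 * g r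
      + a3 * f r ^ 2 + a4 * (f r * g r) + a5 * g r ^ 2 + a6 * f r ^ 3 + a7 * (f r ^ 2 * g r)
      + a8 * (f r * g r ^ 2) + a9 * g r ^ 3 + a10 * (f r ^ 2 * g r ^ 2))
      ((a1 + 2 * a3 * f s + a4 * g s + 3 * a6 * f s ^ 2 + 2 * a7 * f s * g s + a8 * g s ^ 2
        + 2 * a10 * f s * g s ^ 2) * f' +
       (a2 + 2 * a5 * g s + a4 * f s + 3 * a9 * g s ^ 2 + 2 * a8 * f s * g s + a7 * f s ^ 2
        + 2 * a10 * f s ^ 2 * g s) * g') s := by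
    intro a0 a1 a2 a3 a4 a5 a6 a7 a8 a9 a10
    have := (((((((((((hf.const_mul a1).const_add a0).add (hg.const_mul a2)).add
      ((hf.fun_pow 2).const_mul a3)).add ((hf.fun_mul hg).const_mul a4)).add
      ((hg.fun_pow 2).const_mul a5)).add ((hf.fun_pow 3).const_mul a6)).add
      (((hf.fun_pow 2).fun_mul hg).const_mul a7)).add ((hf.fun_mul (hg.fun_pow 2)).const_mul a8)).add
      ((hg.fun_pow 3).const_mul a9)).add (((hf.fun_pow 2).fun_mul (hg.fun_pow 2)).const_mul a10))
    refine this.congr_deriv ?_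
    push_cast
    ring
  have a : ℂ := 0
  set A : ℂ := (1 + Complex.I) / 8 with hA
  set B : ℂ := (1 - Complex.I) / 8 with hB
  have K : ∀ {u : ℝ → ℂ} {u' : ℂ} (a0 a1 a2 a3 a4 a5 a6 a7 a8 a9 a10 : ℂ),
      (∀ r, u r = a0 + a1 * f r + a2 * g r
      + a3 * f r ^ 2 + a4 * (f r * g r) + a5 * g r ^ 2 + a6 * f r ^ 3 + a7 * (f r ^ 2 * g r)
      + a8 * (f r * g r ^ 2) + a9 * g r ^ 3 + a10 * (f r ^ 2 * g r ^ 2)) →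
      u' = ((a1 + 2 * a3 * f s + a4 * g s + 3 * a6 * f s ^ 2 + 2 * a7 * f s * g s + a8 * g s ^ 2
        + 2 * a10 * f s * g s ^ 2) * f' +
       (a2 + 2 * a5 * g s + a4 * f s + 3 * a9 * g s ^ 2 + 2 * a8 * f s * g s + a7 * f s ^ 2
        + 2 * a10 * f s ^ 2 * g s) * g') → HasDerivAt u u' s := by
    intro u u' a0 a1 a2 a3 a4 a5 a6 a7 a8 a9 a10 h1 h2
    rw [h2, funext h1]
    exact H ..
  match i, j with
  | 0, 0 => exact K (1 - 24 * c * t) 0 0 0 0 0 (c * A) (3 * c * B) (3 * c * A) (c * B) 1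
              (by intro r; simp only [nvP]; ring) (by simp only [nvP]; ring)
  | 1, 0 => exact K 0 0 0 (3 * c * A) (6 * c * B) (3 * c * A) 0 0 2 0 0
              (by intro r; simp only [nvP]; ring) (by simp only [nvP]; ring)
  | 0, 1 => exact K 0 0 0 (3 * c * B) (6 * c * A) (3 * c * B) 0 2 0 0 0
              (by intro r; simp only [nvP]; ring) (by simp only [nvP]; ring)
  | 2, 0 => exact K 0 (6 * c * A) (6 * c * B) 0 0 2 0 0 0 0 0
              (by intro r; simp only [nvP]; ring) (by simp only [nvP]; ring)
  | 1, 1 => exact K 0 (6 * c * B) (6 * c * A) 0 4 0 0 0 0 0 0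
              (by intro r; simp only [nvP]; ring) (by simp only [nvP]; ring)
  | 0, 2 => exact K 0 (6 * c * A) (6 * c * B) 2 0 0 0 0 0 0 0
              (by intro r; simp only [nvP]; ring) (by simp only [nvP]; ring)
  | 3, 0 => exact K (6 * c * A) 0 0 0 0 0 0 0 0 0 0
              (by intro r; simp only [nvP]; ring) (by simp only [nvP]; ring)
  | 2, 1 => exact K (6 * c * B) 0 4 0 0 0 0 0 0 0 0
              (by intro r; simp only [nvP]; ring) (by simp only [nvP]; ring)
  | 1, 2 => exact K (6 * c * A) 4 0 0 0 0 0 0 0 0 0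
              (by intro r; simp only [nvP]; ring) (by simp only [nvP]; ring)
  | 0, 3 => exact K (6 * c * B) 0 0 0 0 0 0 0 0 0 0
              (by intro r; simp only [nvP]; ring) (by simp only [nvP]; ring)
  | 2, 2 => exact K 4 0 0 0 0 0 0 0 0 0 0
              (by intro r; simp only [nvP]; ring) (by simp only [nvP]; ring)
  | 3, 1 | 1, 3 | 3, 2 | 2, 3 | 3, 3 | 0, 4 | 1, 4 | 2, 4 | 3, 4
  | 0, (n+5) | 1, (n+5) | 2, (n+5) | 3, (n+5) | (n+4), m =>
    exact K 0 0 0 0 0 0 0 0 0 0 0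
              (by intro r; simp [nvP]) (by simp [nvP])

def NvWD (c : ℝ) (f fz fw : ℝ → ℝ → ℝ → ℂ) : Prop :=
  ∀ t x y, 0 < nvF c t x y →
    HasDerivAt (fun s => f t s y) (fz t x y + fw t x y) x ∧
    HasDerivAt (fun s => f t x s) (Complex.I * (fz t x y - fw t x y)) y

lemma nvP_ne {c t x y : ℝ} (h : 0 < nvF c t x y) : nvP c t (zz x y) (ww x y) 0 0 ≠ 0 := by
  rw [nvP_ofReal]
  exact_mod_cast h.ne'

lemma NvWD_ev (c : ℝ) (e : NvE) : NvWD c (ev c e) (ev c (dz e)) (ev c (dw e)) := by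
  induction e with
  | P i j =>
    intro t x y h
    simp only [ev, dz, dw]
    exact ⟨(nvP_comp c t i j (zz_x x y) (ww_x x y)).congr_deriv (by ring),
      (nvP_comp c t i j (zz_y x y) (ww_y x y)).congr_deriv (by ring)⟩
  | Q =>
    intro t x y h
    have h0 := nvP_ne h
    simp only [ev, dz, dw]
    refine ⟨((nvP_comp c t 0 0 (zz_x x y) (ww_x x y)).fun_inv h0).congr_deriv ?_,
      ((nvP_comp c t 0 0 (zz_y x y) (ww_y x y)).fun_inv h0).congr_deriv ?_⟩ <;>
    · simp only [zero_add]
      field_simp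
      ring
  | k a =>
    intro t x y h
    simp only [ev, dz, dw]
    exact ⟨(hasDerivAt_const x a).congr_deriv (by ring), (hasDerivAt_const y a).congr_deriv (by ring)⟩
  | add a b ha hb =>
    intro t x y h
    simp only [ev, dz, dw]
    exact ⟨((ha t x y h).1.fun_add (hb t x y h).1).congr_deriv (by ring),
      ((ha t x y h).2.fun_add (hb t x y h).2).congr_deriv (by ring)⟩
  | mul a b ha hb =>
    intro t x y h
    simp only [ev, dz, dw]
    exact ⟨((ha t x y h).1.fun_mul (hb t x y h).1).congr_deriv (by ring),
      ((ha t x y h).2.fun_mul (hb t x y h).2).congr_deriv (by ring)⟩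

lemma nvP_t (c t : ℝ) (z w : ℂ) (i j : ℕ) (x y : ℝ) :
    HasDerivAt (fun s : ℝ => nvP c s z w i j) (ev c (dt c (P i j)) t x y) t := by
  have h0 : HasDerivAt (fun s : ℝ => nvP c s z w 0 0) (-24 * c) t := by
    simp only [nvP]
    have h1 : HasDerivAt (fun s : ℝ => (s : ℂ)) 1 t := (hasDerivAt_id t).ofReal_comp
    exact ((((h1.const_mul (24 * (c : ℂ))).const_sub 1).add_const _).add_const _).congr_deriv
      (by ring)
  rcases i with _ | i
  · rcases j with _ | j
    · simpa [dt, ev] using h0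
    · have : (fun s : ℝ => nvP c s z w 0 (j+1)) = fun _ => nvP c 0 z w 0 (j+1) := by
        funext s
        rcases j with _ | _ | _ | j <;> simp [nvP]
      rw [this]
      simpa [dt, ev] using hasDerivAt_const t _
  · have : (fun s : ℝ => nvP c s z w (i+1) j) = fun _ => nvP c 0 z w (i+1) j := by
      funext s
      rcases i with _ | _ | _ | i <;> rcases j with _ | _ | _ | j <;> simp [nvP]
    rw [this]
    simpa [dt, ev] using hasDerivAt_const t _

lemma ev_t (c : ℝ) (e : NvE) (t x y : ℝ) (h : 0 < nvF c t x y) :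
    HasDerivAt (fun s => ev c e s x y) (ev c (dt c e) t x y) t := by
  induction e with
  | P i j => exact nvP_t c t _ _ i j x y
  | Q =>
    have h0 := nvP_ne h
    have := (nvP_t c t (zz x y) (ww x y) 0 0 x y).fun_inv h0
    simp only [ev, dt] at this ⊢
    refine this.congr_deriv ?_
    field_simp
  | k a =>
    simp only [ev, dt]
    exact hasDerivAt_const t a
  | add a b ha hb =>
    simp only [ev, dt]
    exact ha.fun_add hb
  | mul a b ha hb =>
    simp only [ev, dt]
    exact ha.fun_mul hb

def NvEq (c : ℝ) (f : ℝ → ℝ → ℝ → ℂ) (e : NvE) : Prop :=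
  ∀ t x y, 0 < nvF c t x y → f t x y = ev c e t x y

lemma nv_nhds (c t x y : ℝ) (h : 0 < nvF c t x y) :
    (∀ᶠ s in nhds t, 0 < nvF c s x y) ∧ (∀ᶠ s in nhds x, 0 < nvF c t s y) ∧
    (∀ᶠ s in nhds y, 0 < nvF c t x s) := by
  refine ⟨?_, ?_, ?_⟩
  · have : Continuous (fun s => nvF c s x y) := by unfold nvF; fun_prop
    exact this.continuousAt.eventually (lt_mem_nhds h)
  · have : Continuous (fun s => nvF c t s y) := by unfold nvF; fun_prop
    exact this.continuousAt.eventually (lt_mem_nhds h)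
  · have : Continuous (fun s => nvF c t x s) := by unfold nvF; fun_prop
    exact this.continuousAt.eventually (lt_mem_nhds h)

lemma NvEq.hasX {c : ℝ} {f : ℝ → ℝ → ℝ → ℂ} {e : NvE} (hf : NvEq c f e)
    {t x y : ℝ} (h : 0 < nvF c t x y) :
    pX f t x y = ev c (dz e) t x y + ev c (dw e) t x y := by
  refine (((NvWD_ev c e t x y h).1).congr_of_eventuallyEq ?_).deriv
  filter_upwards [(nv_nhds c t x y h).2.1] with s hs using hf _ _ _ hs

lemma NvEq.hasY {c : ℝ} {f : ℝ → ℝ → ℝ → ℂ} {e : NvE} (hf : NvEq c f e)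
    {t x y : ℝ} (h : 0 < nvF c t x y) :
    pY f t x y = Complex.I * (ev c (dz e) t x y - ev c (dw e) t x y) := by
  refine (((NvWD_ev c e t x y h).2).congr_of_eventuallyEq ?_).deriv
  filter_upwards [(nv_nhds c t x y h).2.2] with s hs using hf _ _ _ hs

lemma NvEq.hasT {c : ℝ} {f : ℝ → ℝ → ℝ → ℂ} {e : NvE} (hf : NvEq c f e) :
    NvEq c (pT f) (dt c e) := by
  intro t x y h
  refine ((ev_t c e t x y h).congr_of_eventuallyEq ?_).deriv
  filter_upwards [(nv_nhds c t x y h).1] with s hs using hf _ _ _ hs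

lemma nv_pZ {f : ℝ → ℝ → ℝ → ℂ} {t x y : ℝ} {a b : ℂ} (h1 : pX f t x y = a + b)
    (h2 : pY f t x y = Complex.I * (a - b)) : pZ f t x y = a ∧ pZbar f t x y = b := by
  have h := Complex.I_sq
  unfold pZ pZbar
  rw [h1, h2]
  constructor
  · linear_combination (-(a - b) / 2) * h
  · linear_combination ((a - b) / 2) * h

lemma NvEq.Z {c : ℝ} {f : ℝ → ℝ → ℝ → ℂ} {e : NvE} (hf : NvEq c f e) :
    NvEq c (pZ f) (dz e) := fun _ _ _ h => (nv_pZ (hf.hasX h) (hf.hasY h)).1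

lemma NvEq.W {c : ℝ} {f : ℝ → ℝ → ℝ → ℂ} {e : NvE} (hf : NvEq c f e) :
    NvEq c (pZbar f) (dw e) := fun _ _ _ h => (nv_pZ (hf.hasX h) (hf.hasY h)).2

lemma nv_log (c : ℝ) : NvEq c (pZ (fun t x y => ((Real.log (nvF c t x y) : ℝ) : ℂ))) (mul (P 1 0) Q) ∧
    NvEq c (pZbar (fun t x y => ((Real.log (nvF c t x y) : ℝ) : ℂ))) (mul (P 0 1) Q) := by
  have key : ∀ (g : ℝ → ℝ) (s : ℝ) (d : ℂ), 0 < g s → DifferentiableAt ℝ g s →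
      HasDerivAt (fun r => (g r : ℂ)) d s →
      deriv (fun r => ((Real.log (g r) : ℝ) : ℂ)) s = d * ((g s : ℝ) : ℂ)⁻¹ := by
    intro g s d h hg hd
    have h1 := hg.hasDerivAt
    have h2 : ((deriv g s : ℝ) : ℂ) = d := h1.ofReal_comp.unique hd
    have h3 := (h1.log h.ne').ofReal_comp.deriv
    rw [h3, ← h2]
    push_cast
    rw [div_eq_mul_inv]
  have main : ∀ t x y, 0 < nvF c t x y →
    pZ (fun t x y => ((Real.log (nvF c t x y) : ℝ) : ℂ)) t x y = ev c (mul (P 1 0) Q) t x y ∧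
    pZbar (fun t x y => ((Real.log (nvF c t x y) : ℝ) : ℂ)) t x y = ev c (mul (P 0 1) Q) t x y := by
    intro t x y h
    have hP : ∀ t x y, ev c (P 0 0) t x y = ((nvF c t x y : ℝ) : ℂ) := fun t x y => nvP_ofReal c t x y
    obtain ⟨hx, hy⟩ := NvWD_ev c (P 0 0) t x y h
    simp only [hP] at hx hy
    apply nv_pZ
    · unfold pX
      rw [key (fun s => nvF c t s y) x _ h (by unfold nvF; fun_prop) hx, ← hP]
      simp only [ev, dz, dw]
      ring
    · unfold pY
      rw [key (fun s => nvF c t x s) y _ h (by unfold nvF; fun_prop) hy, ← hP]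
      simp only [ev, dz, dw]
      ring
  exact ⟨fun t x y h => (main t x y h).1, fun t x y h => (main t x y h).2⟩

lemma nv_conj_zz (x y : ℝ) : (starRingEnd ℂ) (zz x y) = ww x y := by
  simp [zz, ww, sub_eq_add_neg]

lemma nv_conj_ww (x y : ℝ) : (starRingEnd ℂ) (ww x y) = zz x y := by
  simp [zz, ww]

lemma nv_conj_w (c t x y : ℝ) :
    (starRingEnd ℂ) (ev c (mul (k 24) (dz (mul (P 1 0) Q))) t x y)
      = ev c (mul (k 24) (dw (mul (P 0 1) Q))) t x y := by
  have h0 : (starRingEnd ℂ) (nvP c t (zz x y) (ww x y) 0 0) = nvP c t (zz x y) (ww x y) 0 0 := by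
    rw [nvP_ofReal, Complex.conj_ofReal]
  have h1 : (starRingEnd ℂ) (nvP c t (zz x y) (ww x y) 1 0) = nvP c t (zz x y) (ww x y) 0 1 := by
    simp [nvP, nv_conj_zz, nv_conj_ww, Complex.conj_ofNat]
    ring
  have h2 : (starRingEnd ℂ) (nvP c t (zz x y) (ww x y) 2 0) = nvP c t (zz x y) (ww x y) 0 2 := by
    simp [nvP, nv_conj_zz, nv_conj_ww, Complex.conj_ofNat]
    left
    ring
  have h24 : (starRingEnd ℂ) (24 : ℂ) = 24 := Complex.conj_ofNat 24
  simp only [ev, dz, dw, map_mul, map_add, map_inv₀, h0, h1, h2, map_neg, map_one, h24]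


set_option maxHeartbeats 4000000 in
lemma nv_identity (c : ℝ) (t x y : ℝ) (V W U : NvE)
    (hV : V = mul (k (-8)) (dz (mul (P 0 1) Q)))
    (hW : W = mul (k 24) (dz (mul (P 1 0) Q)))
    (hU : U = mul (k 24) (dw (mul (P 0 1) Q))) :
    ev c (dt c V) t x y = 8 * (ev c (dz (dz (dz V))) t x y + ev c (dw (dw (dw V))) t x y)
      + 2 * ev c (dz (mul V W)) t x y + 2 * ev c (dw (mul V U)) t x y := by
  subst hV hW hU
  simp only [ev, dz, dw, dt, zero_add, Nat.reduceAdd]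
  generalize (nvP c t (zz x y) (ww x y) 0 0)⁻¹ = q
  have hk : ∀ Y, Y = nvP c t (zz x y) (ww x y) → -(Y 1 1 * q ^ 2 * (c : ℂ) * 192) + Y 1 1 * q ^ 2 * Y 3 0 * 128 + Y 1 1 * q ^ 2 * Y 0 3 * 128
      - Y 1 1 * q ^ 3 * Y 0 1 * Y 0 2 * 384 - Y 1 1 * q ^ 3 * Y 1 0 * Y 2 0 * 384 + q * Y 4 1 * 64 + q * Y 1 4 * 64
      - q ^ 2 * Y 0 1 * Y 4 0 * 64 - q ^ 2 * Y 0 1 * Y 1 3 * 256 - q ^ 2 * Y 1 0 * Y 3 1 * 256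
      - q ^ 2 * Y 1 0 * Y 0 4 * 64 + q ^ 3 * Y 0 1 * Y 1 0 * (c : ℂ) * 384 + q ^ 3 * Y 0 1 * Y 1 0 * Y 3 0 * 128
      + q ^ 3 * Y 0 1 * Y 1 0 * Y 0 3 * 128 + q ^ 3 * Y 0 1 ^ 2 * Y 1 2 * 384 + q ^ 3 * Y 1 0 ^ 2 * Y 2 1 * 384 = 0 := by
    rintro Y rfl
    simp only [nvP]
    generalize zz x y = z
    generalize ww x y = w
    ring
  replace hk := hk _ rfl
  generalize nvP c t (zz x y) (ww x y) = Y at hk ⊢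
  linear_combination hk

theorem stmt10 (c : ℝ)
    (F : ℝ → ℝ → ℝ → ℝ)
    (hF : F = fun t x y => 1 - 24 * c * t + c * (x ^ 3 + y ^ 3) + (x ^ 2 + y ^ 2) ^ 2)
    (logF : ℝ → ℝ → ℝ → ℂ) (hlogF : logF = fun t x y => ((Real.log (F t x y) : ℝ) : ℂ))
    (v w : ℝ → ℝ → ℝ → ℂ)
    (hv : v = fun t x y => -8 * pZ (pZbar logF) t x y)
    (hw : w = fun t x y => 24 * pZ (pZ logF) t x y) :
    ∀ t x y : ℝ, 0 < F t x y →
      (pT v t x y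
          = 8 * (pZ (pZ (pZ v)) t x y + pZbar (pZbar (pZbar v)) t x y)
            + 2 * pZ (fun t x y => v t x y * w t x y) t x y
            + 2 * pZbar (fun t x y => v t x y * (starRingEnd ℂ) (w t x y)) t x y)
      ∧ pZbar w t x y = -3 * pZ v t x y := by
  have hFF : F = nvF c := by rw [hF]; rfl
  intro t x y h
  rw [hFF] at hlogF h
  obtain ⟨l1, l2⟩ := nv_log c
  rw [← hlogF] at l1 l2
  have eV : NvEq c v (mul (k (-8)) (dz (mul (P 0 1) Q))) := by
    intro t x y h
    rw [hv]
    simp only [l2.Z t x y h, ev]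
  have eW : NvEq c w (mul (k 24) (dz (mul (P 1 0) Q))) := by
    intro t x y h
    rw [hw]
    simp only [l1.Z t x y h, ev]
  have eU : NvEq c (fun t x y => (starRingEnd ℂ) (w t x y)) (mul (k 24) (dw (mul (P 0 1) Q))) := by
    intro t x y h
    simp only [eW t x y h]
    exact nv_conj_w c t x y
  constructor
  · have hVW : NvEq c (fun t x y => v t x y * w t x y) (mul _ _) :=
      fun t x y h => congrArg₂ (· * ·) (eV t x y h) (eW t x y h)
    have hVU : NvEq c (fun t x y => v t x y * (starRingEnd ℂ) (w t x y)) (mul _ _) :=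
      fun t x y h => congrArg₂ (· * ·) (eV t x y h) (eU t x y h)
    rw [eV.hasT t x y h, eV.Z.Z.Z t x y h, eV.W.W.W t x y h, hVW.Z t x y h, hVU.W t x y h]
    exact nv_identity c t x y _ _ _ rfl rfl rfl
  · rw [eW.W t x y h, eV.Z t x y h]
    simp only [ev, dz, dw, zero_add, Nat.reduceAdd]
    ring
end

section
/- Let c₀ = 4 · 3^{−3/4} and F(t, x, y) = 1 − 24 c t + c(x³ + y³) + (x² + y²)². For every c ∈ (−c₀, 0): F(t, x, y) > 0 for all t ≥ 0 and all (x, y) ∈ ℝ², and the function Q_{2,c}(t, x, y) := −2 Δ_{x,y} log F(t, x, y) satisfies sup_{(x,y) ∈ ℝ²} |Q_{2,c}(t, x, y)| → 0 as t → +∞; that is, the solution Q_{2,c} of the zero-energy Novikov–Veselov equation scatters to zero as t → +∞. -/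
/-- Second partial derivative in `x` plus second partial derivative in `y`
(the spatial Laplacian) of a function `(t, x, y) ↦ f t x y`. -/
noncomputable def spatialLaplacian (f : ℝ → ℝ → ℝ → ℝ) (t x y : ℝ) : ℝ :=
  deriv (fun s => deriv (fun s' => f t s' y) s) x
    + deriv (fun s => deriv (fun s' => f t x s') s) y

lemma quart_bound (a r : ℝ) : a * r ^ 3 ≤ r ^ 4 + 27 * a ^ 4 / 256 := by
  nlinarith [mul_nonneg (sq_nonneg (r - 3 * a / 4)) (add_nonneg (sq_nonneg (r + a / 4)) (sq_nonneg a)),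
    mul_nonneg (sq_nonneg (r - 3 * a / 4)) (sq_nonneg (r + a / 4)),
    mul_nonneg (sq_nonneg (r - 3 * a / 4)) (sq_nonneg a)]

lemma cube_bound (x y r : ℝ) (hr : 0 ≤ r) (h : r ^ 2 = x ^ 2 + y ^ 2) : x ^ 3 + y ^ 3 ≤ r ^ 3 := by
  have hx : x ≤ r := by nlinarith [sq_nonneg y]
  have hy : y ≤ r := by nlinarith [sq_nonneg x]
  have : r ^ 3 = r * x ^ 2 + r * y ^ 2 := by rw [← mul_add, ← h]; ring
  nlinarith [mul_nonneg (sub_nonneg.2 hx) (sq_nonneg x), mul_nonneg (sub_nonneg.2 hy) (sq_nonneg y)]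

lemma a_bound (a : ℝ) (ha : 0 < a) (h : a < 4 * (3 : ℝ) ^ (-(3 : ℝ) / 4)) : 27 * a ^ 4 / 256 < 1 := by
  have h4 : a ^ 4 < (4 * (3 : ℝ) ^ (-(3 : ℝ) / 4)) ^ 4 := pow_lt_pow_left₀ h ha.le (by norm_num)
  have h5 : ((3 : ℝ) ^ (-(3 : ℝ) / 4)) ^ 4 = 1 / 27 := by
    rw [← Real.rpow_natCast, ← Real.rpow_mul (by norm_num)]
    have : (-(3 : ℝ) / 4 * ((4 : ℕ) : ℝ)) = ((-3 : ℤ) : ℝ) := by norm_num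
    rw [this, Real.rpow_intCast]; norm_num
  rw [mul_pow, h5] at h4
  linarith

lemma deriv2_log (f f' : ℝ → ℝ) (f'' x : ℝ) (hp : ∀ s, 0 < f s) (h1 : ∀ s, HasDerivAt f (f' s) s)
    (h2 : HasDerivAt f' f'' x) :
    deriv (fun s => deriv (fun s' => Real.log (f s')) s) x
      = (f'' * f x - f' x * f' x) / f x ^ 2 := by
  have : (fun s => deriv (fun s' => Real.log (f s')) s) = fun s => f' s / f s := by
    funext s
    exact ((h1 s).log (hp s).ne').deriv
  rw [this]
  exact (h2.div (h1 x) (hp x).ne').deriv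

lemma part_deriv (c k y : ℝ) (x : ℝ)
    (hp : ∀ s, 0 < k + c * s ^ 3 + (s ^ 2 + y ^ 2) ^ 2) :
    deriv (fun s => deriv (fun s' => Real.log (k + c * s' ^ 3 + (s' ^ 2 + y ^ 2) ^ 2)) s) x
      = ((6 * c * x + 12 * x ^ 2 + 4 * y ^ 2) * (k + c * x ^ 3 + (x ^ 2 + y ^ 2) ^ 2)
        - (3 * c * x ^ 2 + 4 * x * (x ^ 2 + y ^ 2)) ^ 2) / (k + c * x ^ 3 + (x ^ 2 + y ^ 2) ^ 2) ^ 2 := by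
  rw [deriv2_log (fun s => k + c * s ^ 3 + (s ^ 2 + y ^ 2) ^ 2)
    (fun s => 3 * c * s ^ 2 + 4 * s * (s ^ 2 + y ^ 2)) (6 * c * x + 12 * x ^ 2 + 4 * y ^ 2) x hp]
  · simp only [sq]
  · intro s
    have := (((hasDerivAt_pow 3 s).const_mul c).const_add k).add
      (((hasDerivAt_pow 2 s).add_const (y ^ 2)).pow 2)
    refine this.congr_deriv ?_
    norm_num; ring
  · have := ((hasDerivAt_pow 2 x).const_mul (3 * c)).add
      (((hasDerivAt_id x).const_mul 4).mul ((hasDerivAt_pow 2 x).add_const (y ^ 2)))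
    refine this.congr_deriv ?_
    norm_num; ring

lemma final_bound (c x y f r s : ℝ) (hf : 0 < f) (hs : 1 ≤ s) (h : r ^ 2 = x ^ 2 + y ^ 2)
    (h1 : s ^ 2 + r ^ 4 ≤ 2 * f) :
    |(6 * c * (x + y) + 16 * r ^ 2) / f - ((3 * c * x ^ 2 + 4 * x * r ^ 2) ^ 2
      + (3 * c * y ^ 2 + 4 * y * r ^ 2) ^ 2) / f ^ 2| ≤ (30 * c ^ 2 + 86) / s := by
  have hs0 : 0 < s := by linarith
  have e1 : s * r ^ 2 ≤ f := by nlinarith [sq_nonneg (s - r ^ 2)]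
  have e2 : r ^ 4 ≤ 2 * f := by nlinarith [sq_nonneg s]
  have e3 : s ≤ 2 * f := by nlinarith [sq_nonneg (r ^ 2)]
  have r0 := sq_nonneg r
  have c0 := sq_nonneg c
  have A : |6 * c * (x + y) + 16 * r ^ 2| ≤ 6 * c ^ 2 + 22 * r ^ 2 := by
    rw [abs_le]; constructor <;>
    nlinarith [sq_nonneg (c + x), sq_nonneg (c + y), sq_nonneg (c - x), sq_nonneg (c - y)]
  have A' : |(6 * c * (x + y) + 16 * r ^ 2) / f| ≤ (12 * c ^ 2 + 22) / s := by
    rw [abs_div, abs_of_pos hf, div_le_div_iff₀ hf hs0]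
    have := mul_le_mul_of_nonneg_right A hs0.le
    nlinarith [mul_le_mul_of_nonneg_left e3 c0]
  have B : (3 * c * x ^ 2 + 4 * x * r ^ 2) ^ 2 + (3 * c * y ^ 2 + 4 * y * r ^ 2) ^ 2
      ≤ 18 * c ^ 2 * r ^ 4 + 32 * r ^ 6 := by
    have i1 : (3 * c * x ^ 2 + 4 * x * r ^ 2) ^ 2 ≤ 18 * c ^ 2 * x ^ 4 + 32 * x ^ 2 * r ^ 4 := by
      nlinarith [sq_nonneg (3 * c * x ^ 2 - 4 * x * r ^ 2)]
    have i2 : (3 * c * y ^ 2 + 4 * y * r ^ 2) ^ 2 ≤ 18 * c ^ 2 * y ^ 4 + 32 * y ^ 2 * r ^ 4 := by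
      nlinarith [sq_nonneg (3 * c * y ^ 2 - 4 * y * r ^ 2)]
    have i3 : r ^ 6 = x ^ 2 * r ^ 4 + y ^ 2 * r ^ 4 := by rw [← add_mul, ← h]; ring
    have i4 : x ^ 4 + y ^ 4 ≤ r ^ 4 := by
      have : r ^ 4 = (x ^ 2 + y ^ 2) ^ 2 := by rw [← h]; ring
      nlinarith [mul_nonneg (sq_nonneg x) (sq_nonneg y)]
    nlinarith [mul_le_mul_of_nonneg_left i4 c0]
  have B' : |((3 * c * x ^ 2 + 4 * x * r ^ 2) ^ 2
      + (3 * c * y ^ 2 + 4 * y * r ^ 2) ^ 2) / f ^ 2| ≤ (18 * c ^ 2 + 64) / s := by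
    rw [abs_of_nonneg (by positivity), div_le_div_iff₀ (by positivity) hs0]
    have j1 : r ^ 4 * s ≤ f ^ 2 := by
      have : (s * r ^ 2) ^ 2 ≤ f ^ 2 := pow_le_pow_left₀ (by positivity) e1 2
      have : r ^ 4 * s ≤ (s * r ^ 2) ^ 2 := by
        have : 0 ≤ r ^ 4 * s := by positivity
        nlinarith
      linarith
    have j2 : r ^ 6 * s ≤ 2 * f ^ 2 := by
      have := mul_le_mul e1 e2 (by positivity) hf.le
      nlinarith
    have := mul_le_mul_of_nonneg_right B hs0.le
    nlinarith [mul_le_mul_of_nonneg_left j1 c0]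
  calc _ ≤ _ := abs_sub _ _
    _ ≤ (12 * c ^ 2 + 22) / s + (18 * c ^ 2 + 64) / s := add_le_add A' B'
    _ = _ := by ring

theorem stmt12 (c : ℝ) (hc0 : c < 0) (hc : -(4 * (3 : ℝ) ^ (-(3 : ℝ) / 4)) < c)
    (F : ℝ → ℝ → ℝ → ℝ)
    (hF : F = fun t x y => 1 - 24 * c * t + c * (x ^ 3 + y ^ 3) + (x ^ 2 + y ^ 2) ^ 2)
    (Q : ℝ → ℝ → ℝ → ℝ)
    (hQ : Q = fun t x y => -2 * spatialLaplacian (fun t x y => Real.log (F t x y)) t x y) :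
    (∀ t x y : ℝ, 0 ≤ t → 0 < F t x y) ∧
    (∀ ε : ℝ, 0 < ε → ∃ M : ℝ, ∀ t : ℝ, M ≤ t → ∀ x y : ℝ, |Q t x y| ≤ ε) := by
  have pos : ∀ t x y : ℝ, 0 ≤ t → 0 < F t x y := by
    intro t x y ht
    have hr := Real.sqrt_nonneg (x ^ 2 + y ^ 2)
    have hr2 := Real.sq_sqrt (show 0 ≤ x ^ 2 + y ^ 2 by positivity)
    set r := Real.sqrt (x ^ 2 + y ^ 2)
    have h1 := cube_bound x y r hr hr2
    have h2 := a_bound (-c) (by linarith) (by linarith)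
    have h3 := quart_bound (-c) r
    have h4 := mul_le_mul_of_nonneg_left h1 (show 0 ≤ -c by linarith)
    have h5 : 0 ≤ -c * t := mul_nonneg (by linarith) ht
    rw [hF]
    simp only [← hr2]
    nlinarith
  refine ⟨pos, ?_⟩
  intro ε hε
  set s : ℝ := 1 + (60 * c ^ 2 + 172) / ε + 27 * c ^ 4 / 16 with hsdef
  have p1 : 0 ≤ (60 * c ^ 2 + 172) / ε := by positivity
  have p2 : 0 ≤ 27 * c ^ 4 / 16 := by positivity
  have hs1 : 1 ≤ s := by linarith
  have hs2 : 27 * c ^ 4 / 16 ≤ s ^ 2 := by nlinarith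
  refine ⟨s ^ 2 / (24 * (-c)), fun t ht x y => ?_⟩
  have hT : s ^ 2 ≤ 24 * (-c) * t := by
    rw [div_le_iff₀ (by linarith)] at ht; linarith
  have ht0 : 0 ≤ t := le_trans (div_nonneg (sq_nonneg _) (by linarith)) ht
  have hr := Real.sqrt_nonneg (x ^ 2 + y ^ 2)
  have hr2 := Real.sq_sqrt (show 0 ≤ x ^ 2 + y ^ 2 by positivity)
  set r := Real.sqrt (x ^ 2 + y ^ 2)
  have hf := pos t x y ht0
  have hFr : F t x y = 1 - 24 * c * t + c * (x ^ 3 + y ^ 3) + r ^ 4 := by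
    rw [hF]; simp only [← hr2]; ring
  have hlow : s ^ 2 + r ^ 4 ≤ 2 * F t x y := by
    have h1 := cube_bound x y r hr hr2
    have h3 := quart_bound (2 * (-c)) r
    have h4 := mul_le_mul_of_nonneg_left h1 (show 0 ≤ -c by linarith)
    rw [hFr]
    nlinarith
  have hb := final_bound c x y (F t x y) r s hf hs1 hr2 hlow
  have hx : deriv (fun s => deriv (fun s' => Real.log (F t s' y)) s) x
      = ((6 * c * x + 12 * x ^ 2 + 4 * y ^ 2) * F t x y
        - (3 * c * x ^ 2 + 4 * x * (x ^ 2 + y ^ 2)) ^ 2) / F t x y ^ 2 := by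
    have e : ∀ s, F t s y = (1 - 24 * c * t + c * y ^ 3) + c * s ^ 3 + (s ^ 2 + y ^ 2) ^ 2 := by
      intro s; rw [hF]; ring
    have := part_deriv c (1 - 24 * c * t + c * y ^ 3) y x (fun s => by rw [← e]; exact pos t s y ht0)
    simp only [← e] at this
    exact this
  have hy : deriv (fun s => deriv (fun s' => Real.log (F t x s')) s) y
      = ((6 * c * y + 12 * y ^ 2 + 4 * x ^ 2) * F t x y
        - (3 * c * y ^ 2 + 4 * y * (y ^ 2 + x ^ 2)) ^ 2) / F t x y ^ 2 := by
    have e : ∀ s, F t x s = (1 - 24 * c * t + c * x ^ 3) + c * s ^ 3 + (s ^ 2 + x ^ 2) ^ 2 := by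
      intro s; rw [hF]; ring
    have := part_deriv c (1 - 24 * c * t + c * x ^ 3) x y (fun s => by rw [← e]; exact pos t x s ht0)
    simp only [← e] at this
    exact this
  have hQe : Q t x y = -2 * ((6 * c * (x + y) + 16 * r ^ 2) / F t x y
      - ((3 * c * x ^ 2 + 4 * x * r ^ 2) ^ 2
      + (3 * c * y ^ 2 + 4 * y * r ^ 2) ^ 2) / F t x y ^ 2) := by
    rw [hQ]
    simp only [spatialLaplacian]
    rw [hx, hy, hr2]
    generalize F t x y = f at hf
    field_simp
    ring
  rw [hQe, abs_mul]
  have hfin : (60 * c ^ 2 + 172) / s ≤ ε := by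
    rw [div_le_iff₀ (by linarith)]
    have : (60 * c ^ 2 + 172) / ε ≤ s := by linarith
    rw [div_le_iff₀ hε] at this; linarith
  have h2 : |(-2 : ℝ)| = 2 := by norm_num
  rw [h2]
  calc _ ≤ 2 * ((30 * c ^ 2 + 86) / s) := by linarith
    _ = (60 * c ^ 2 + 172) / s := by ring
    _ ≤ ε := hfin
end
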